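/- Let X be an n-poised set and suppose a node A ∈ X uses a line ℓ, so that p⋆_A = ℓ·q with q ∈ Π_{n−1}. Then ℓ passes through at least two nodes of X at which q does not vanish. -/

import Mathlib

open MvPolynomial

/-- Evaluation of a bivariate polynomial at a point of the real plane. -/
noncomputable def ev (p : MvPolynomial (Fin 2) ℝ) (A : ℝ × ℝ) : ℝ :=
  MvPolynomial.eval ![A.1, A.2] p

/-- A polynomial of total degree exactly 1, defining a line. -/
def IsLinePoly (l : MvPolynomial (Fin 2) ℝ) : Prop := l.totalDegree = 1

/-- The line (zero set) defined by a polynomial. -/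
def lineSet (l : MvPolynomial (Fin 2) ℝ) : Set (ℝ × ℝ) := {A | ev l A = 0}

/-- The number of nodes of `X` lying on the line defined by `l`. -/
noncomputable def nodesOn (X : Set (ℝ × ℝ)) (l : MvPolynomial (Fin 2) ℝ) : ℕ :=
  (X ∩ lineSet l).ncard

/-- `X` is an `n`-poised set: it has `N = (n+2)(n+1)/2` nodes and the only polynomial of
degree ≤ n vanishing on all of `X` is the zero polynomial. -/
def Poised (n : ℕ) (X : Set (ℝ × ℝ)) : Prop :=
  X.Finite ∧ X.ncard = (n + 2) * (n + 1) / 2 ∧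
    ∀ p : MvPolynomial (Fin 2) ℝ, p.totalDegree ≤ n → (∀ A ∈ X, ev p A = 0) → p = 0

/-- `p` is an `n`-fundamental polynomial of the node `A` with respect to `X`. -/
def IsFund (n : ℕ) (X : Set (ℝ × ℝ)) (A : ℝ × ℝ) (p : MvPolynomial (Fin 2) ℝ) : Prop :=
  p.totalDegree ≤ n ∧ ev p A = 1 ∧ ∀ B ∈ X, B ≠ A → ev p B = 0

/-- `X` is a `GC_n` set: it is `n`-poised and each fundamental polynomial is a product of
`n` linear (degree-1) polynomials. -/
def GCSet (n : ℕ) (X : Set (ℝ × ℝ)) : Prop :=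
  Poised n X ∧ ∀ A ∈ X, ∃ p : MvPolynomial (Fin 2) ℝ, IsFund n X A p ∧
    ∃ f : Fin n → MvPolynomial (Fin 2) ℝ, (∀ i, IsLinePoly (f i)) ∧ p = ∏ i, f i

/-- The node `A` uses the line `l`: the linear polynomial `l` divides a fundamental
polynomial of `A`. -/
def Uses (n : ℕ) (X : Set (ℝ × ℝ)) (A : ℝ × ℝ) (l : MvPolynomial (Fin 2) ℝ) : Prop :=
  ∃ p, IsFund n X A p ∧ l ∣ p

/-- `X` has no maximal line, i.e. no line passes through `n+1` nodes of `X`. -/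
def NoMaximalLine (n : ℕ) (X : Set (ℝ × ℝ)) : Prop :=
  ∀ l : MvPolynomial (Fin 2) ℝ, IsLinePoly l → nodesOn X l ≠ n + 1

theorem ev_mul (p q : MvPolynomial (Fin 2) ℝ) (A : ℝ × ℝ) : ev (p * q) A = ev p A * ev q A :=
  map_mul _ p q

/-- Through any two distinct points passes the zero set of a nonzero polynomial of degree at
most one. -/
theorem exists_linear_through {A B : ℝ × ℝ} (h : A ≠ B) :
    ∃ m : MvPolynomial (Fin 2) ℝ, m.totalDegree ≤ 1 ∧ m ≠ 0 ∧ ev m A = 0 ∧ ev m B = 0 := by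
  refine ⟨C (B.2 - A.2) * (X 0 - C A.1) - C (B.1 - A.1) * (X 1 - C A.2), ?_, ?_, ?_, ?_⟩
  · have hdeg (a b : ℝ) (i : Fin 2) :
        (C a * (X i - C b) : MvPolynomial (Fin 2) ℝ).totalDegree ≤ 1 := by
      refine (totalDegree_mul _ _).trans ?_
      rw [totalDegree_C, zero_add]
      exact (totalDegree_sub_C_le _ _).trans (totalDegree_X i).le
    exact (totalDegree_sub _ _).trans (max_le (hdeg _ _ _) (hdeg _ _ _))
  · intro h0
    have h1 := congrArg (fun m => ev m (A.1 + (B.2 - A.2), A.2 - (B.1 - A.1))) h0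
    simp only [ev, map_sub, map_mul, eval_C, eval_X, map_zero, Matrix.cons_val_zero,
      Matrix.cons_val_one] at h1
    refine h (Prod.ext ?_ ?_) <;> nlinarith [sq_nonneg (B.2 - A.2), sq_nonneg (B.1 - A.1)]
  · simp [ev]
  · simp [ev]
    ring

/-- if a node `A` of an `n`-poised set uses a line `l`, so that
`p⋆_A = l * q`, then `l` passes through at least two nodes of `X` at which `q` does
not vanish. -/
theorem used_line_two_nodes (n : ℕ) (X : Set (ℝ × ℝ)) (hX : Poised n X)
    (A : ℝ × ℝ) (hA : A ∈ X) (p l q : MvPolynomial (Fin 2) ℝ)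
    (hp : IsFund n X A p) (hl : IsLinePoly l) (hq : q.totalDegree ≤ n - 1)
    (hfac : p = l * q) :
    ∃ B C : ℝ × ℝ, B ∈ X ∧ C ∈ X ∧ B ≠ C ∧
      ev l B = 0 ∧ ev l C = 0 ∧ ev q B ≠ 0 ∧ ev q C ≠ 0 := by
  obtain ⟨-, -, hX⟩ := hX
  obtain ⟨hpn, hpA, hp0⟩ := hp
  subst hfac
  rw [ev_mul] at hpA
  have hlA : ev l A ≠ 0 := fun h => by simp [h] at hpA
  have hl0 : l ≠ 0 := by
    rintro rfl
    simp [ev] at hlA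
  have hq0 : q ≠ 0 := by
    rintro rfl
    simp [ev] at hpA
  have hn : 1 ≤ n := by
    rw [totalDegree_mul_of_isDomain hl0 hq0, hl] at hpn
    omega
  by_contra! hcon
  obtain ⟨B, hAB, hB⟩ : ∃ B, A ≠ B ∧ ∀ D ∈ X, ev l D = 0 → ev q D ≠ 0 → D = B := by
    by_cases hex : ∃ B ∈ X, ev l B = 0 ∧ ev q B ≠ 0
    · obtain ⟨B, hBX, hlB, hqB⟩ := hex
      refine ⟨B, fun h => hlA (h ▸ hlB), fun D hDX hlD hqD => ?_⟩
      by_contra hDB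
      exact hqD (hcon B D hBX hDX (Ne.symm hDB) hlB hlD hqB)
    · refine ⟨(A.1 + 1, A.2), fun h => ?_, fun D hDX hlD hqD => (hex ⟨D, hDX, hlD, hqD⟩).elim⟩
      simpa using congrArg Prod.fst h
  obtain ⟨m, hm, hm0, hmA, hmB⟩ := exists_linear_through hAB
  refine mul_ne_zero hm0 hq0 (hX (m * q) ((totalDegree_mul m q).trans (by omega)) fun D hD => ?_)
  rw [ev_mul, mul_eq_zero]
  by_cases hDA : D = A
  · exact Or.inl (hDA ▸ hmA)
  by_cases hqD : ev q D = 0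
  · exact Or.inr hqD
  have hlD : ev l D = 0 := by simpa [ev_mul, hqD] using hp0 D hD hDA
  exact Or.inl (hB D hD hlD hqD ▸ hmB)
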